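/- The Belavin R-matrix is regular: its value at z = 1 (i.e. at ξ = 0) equals the flip operator, R(1) = P, where P(u ⊗ v) = v ⊗ u on ℂ^N ⊗ ℂ^N. -/

import Mathlib

open Complex Matrix Kronecker

noncomputable section

/-- `eπ x = exp(iπx)`; the variables `z, q, p` of the paper are `eπ ξ, eπ ζ, eπ (2τ)`. -/
def eπ (x : ℂ) : ℂ := Complex.exp (Real.pi * Complex.I * x)

/-- Jacobi theta function with characteristics `ϑ[γ₁,γ₂](u,τ)`. -/
def jTheta (γ₁ γ₂ : ℝ) (u τ : ℂ) : ℂ :=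
  ∑' m : ℤ, Complex.exp (Real.pi * Complex.I * ((m : ℂ) + (γ₁ : ℂ)) ^ 2 * τ +
    2 * Real.pi * Complex.I * ((m : ℂ) + (γ₁ : ℂ)) * (u + (γ₂ : ℂ)))

/-- single infinite Pochhammer symbol `(x;s)_∞`. -/
def poch1 (x s : ℂ) : ℂ := ∏' n : ℕ, (1 - x * s ^ n)

/-- double infinite Pochhammer symbol `(x;p₁,p₂)_∞`. -/
def poch2 (x p₁ p₂ : ℂ) : ℂ := ∏' n : ℕ × ℕ, (1 - x * p₁ ^ n.1 * p₂ ^ n.2)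

/-- Jacobi `Θ_s(x)` function. -/
def ThetaF (s x : ℂ) : ℂ := poch1 x s * poch1 (s * x⁻¹) s * poch1 s s

/-- numerator of `1/κ(z²)`, with `z = eπ ξ`, `q = eπ ζ`, `p = eπ (2τ)`. -/
def kappaNum (N : ℕ) (ξ ζ τ : ℂ) : ℂ :=
  poch2 (eπ (2 * N * ζ - 2 * ξ)) (eπ (2 * τ)) (eπ (2 * N * ζ)) *
  poch2 (eπ (2 * ζ + 2 * ξ)) (eπ (2 * τ)) (eπ (2 * N * ζ)) *
  poch2 (eπ (2 * τ - 2 * ξ)) (eπ (2 * τ)) (eπ (2 * N * ζ)) *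
  poch2 (eπ (2 * τ + (2 * N - 2) * ζ + 2 * ξ)) (eπ (2 * τ)) (eπ (2 * N * ζ))

/-- denominator of `1/κ(z²)`: the numerator with `ξ → -ξ`. -/
def kappaDen (N : ℕ) (ξ ζ τ : ℂ) : ℂ := kappaNum N (-ξ) ζ τ

/-- the diagonal matrix `g^{1/2}` with entries `e^{iπj/N}`, `1 ≤ j ≤ N`. -/
def gHalf (N : ℕ) : Matrix (Fin N) (Fin N) ℂ :=
  Matrix.diagonal fun j => eπ ((((j : ℕ) : ℂ) + 1) / N)

/-- the diagonal matrix `g` with entries `ω^j = e^{2iπj/N}`, `1 ≤ j ≤ N`. -/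
def gMat (N : ℕ) : Matrix (Fin N) (Fin N) ℂ :=
  Matrix.diagonal fun j => eπ (2 * (((j : ℕ) : ℂ) + 1) / N)

/-- the shift matrix `h`, `h_{jl} = δ_{j+1,l}` (mod `N`). -/
def hMat (N : ℕ) : Matrix (Fin N) (Fin N) ℂ :=
  Matrix.of fun j l => if (l : ℕ) = ((j : ℕ) + 1) % N then 1 else 0

/-- `I_{(α₁,α₂)} = g^{α₂} h^{α₁}`. -/
def Imat (N : ℕ) (α : Fin N × Fin N) : Matrix (Fin N) (Fin N) ℂ :=
  gMat N ^ (α.2 : ℕ) * hMat N ^ (α.1 : ℕ)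

/-- the coefficient `W_{(α₁,α₂)}(ξ,ζ,τ)`. -/
def Wcoef (N : ℕ) (α : Fin N × Fin N) (ξ ζ τ : ℂ) : ℂ :=
  jTheta (1/2 + (α.1 : ℕ) / N) (1/2 + (α.2 : ℕ) / N) (ξ + ζ / N) τ /
    (N * jTheta (1/2 + (α.1 : ℕ) / N) (1/2 + (α.2 : ℕ) / N) (ζ / N) τ)

/-- the matrix `𝒵(z)`, `z = eπ ξ`. -/
def Zmat (N : ℕ) (ξ ζ τ : ℂ) : Matrix (Fin N × Fin N) (Fin N × Fin N) ℂ :=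
  (eπ (ξ * (2 / N - 2)) * (kappaNum N ξ ζ τ / kappaDen N ξ ζ τ) *
      jTheta (1/2) (1/2) ζ τ / jTheta (1/2) (1/2) (ξ + ζ) τ) •
    ∑ α : Fin N × Fin N, Wcoef N α ξ ζ τ • (Imat N α ⊗ₖ (Imat N α)⁻¹)

/-- the Belavin R-matrix `R(z)`, as a function of `ξ` with `z = eπ ξ`. -/
def Rmat (N : ℕ) (ξ ζ τ : ℂ) : Matrix (Fin N × Fin N) (Fin N × Fin N) ℂ :=
  (gHalf N ⊗ₖ gHalf N) * Zmat N ξ ζ τ * (gHalf N ⊗ₖ gHalf N)⁻¹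

/-- genericity: every theta-function value and κ-value appearing in a denominator is nonzero. -/
def Rgeneric (N : ℕ) (ξ ζ τ : ℂ) : Prop :=
  jTheta (1/2) (1/2) (ξ + ζ) τ ≠ 0 ∧
  (∀ α : Fin N × Fin N,
    jTheta (1/2 + (α.1 : ℕ) / N) (1/2 + (α.2 : ℕ) / N) (ζ / N) τ ≠ 0) ∧
  kappaDen N ξ ζ τ ≠ 0

/-- the flip (permutation) operator `P` on `ℂ^N ⊗ ℂ^N`. -/
def Pflip (N : ℕ) : Matrix (Fin N × Fin N) (Fin N × Fin N) ℂ :=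
  Matrix.of fun a b => if a.1 = b.2 ∧ a.2 = b.1 then 1 else 0

/-- partial transposition in the second tensor factor. -/
def pt2 {N : ℕ} (M : Matrix (Fin N × Fin N) (Fin N × Fin N) ℂ) :
    Matrix (Fin N × Fin N) (Fin N × Fin N) ℂ :=
  Matrix.of fun a b => M (a.1, b.2) (b.1, a.2)

/-- `τ_N` evaluated at `eπ u` (all fractional powers via exponentials). -/
def tauNe (N : ℕ) (ζ u : ℂ) : ℂ :=
  eπ (u * (2 / N - 2)) * ThetaF (eπ (2 * N * ζ)) (eπ (ζ + 2 * u)) /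
    ThetaF (eπ (2 * N * ζ)) (eπ (ζ - 2 * u))

/-- the normalized Belavin R-matrix `R̂(z) = τ_N(q^{1/2}z⁻¹) R(z)`, as a function of `ξ`. -/
def Rhat (N : ℕ) (ξ ζ τ : ℂ) : Matrix (Fin N × Fin N) (Fin N × Fin N) ℂ :=
  tauNe N ζ (ζ / 2 - ξ) • Rmat N ξ ζ τ


lemma eπ_add' (x y : ℂ) : eπ (x + y) = eπ x * eπ y := by
  simp only [eπ, mul_add, Complex.exp_add]

lemma eπ_zero' : eπ 0 = 1 := by simp [eπ]

lemma eπ_ne_zero' (x : ℂ) : eπ x ≠ 0 := Complex.exp_ne_zero _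

lemma eπ_pow' (x : ℂ) (n : ℕ) : eπ x ^ n = eπ (n * x) := by
  simp only [eπ, ← Complex.exp_nat_mul]
  congr 1
  ring

lemma hMat_pow_apply (N : ℕ) [NeZero N] (n : ℕ) (j l : Fin N) :
    (hMat N ^ n) j l = if (l : ℕ) = ((j : ℕ) + n) % N then 1 else 0 := by
  induction n generalizing j l with
  | zero =>
    simp only [pow_zero, Matrix.one_apply, add_zero, Nat.mod_eq_of_lt j.2, Fin.ext_iff, eq_comm]
  | succ n ih =>
    rw [pow_succ', Matrix.mul_apply]
    have hpos : 0 < N := Nat.pos_of_ne_zero (NeZero.ne N)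
    rw [Finset.sum_eq_single (⟨((j : ℕ) + 1) % N, Nat.mod_lt _ hpos⟩ : Fin N)]
    · rw [ih]
      simp only [hMat, Matrix.of_apply, if_true, one_mul, Nat.mod_add_mod]
      rw [show (j : ℕ) + 1 + n = j + (n + 1) by ring]
    · intro b _ hb
      have : (b : ℕ) ≠ ((j : ℕ) + 1) % N := fun h => hb (Fin.ext h)
      simp [hMat, this]
    · simp

lemma Imat_apply (N : ℕ) [NeZero N] (α : Fin N × Fin N) (j l : Fin N) :
    Imat N α j l = if l = j + α.1 then
      eπ (((α.2 : ℕ) : ℂ) * (2 * (((j : ℕ) : ℂ) + 1) / N)) else 0 := by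
  have hh : (l = j + α.1) ↔ (l : ℕ) = ((j : ℕ) + (α.1 : ℕ)) % N := by
    rw [Fin.ext_iff, Fin.val_add]
  simp only [Imat, gMat, Matrix.diagonal_pow, Matrix.diagonal_mul, hMat_pow_apply, hh,
    Pi.pow_apply, eπ_pow']
  simp

/-- explicit inverse of `Imat`. -/
def Jmat (N : ℕ) [NeZero N] (α : Fin N × Fin N) : Matrix (Fin N) (Fin N) ℂ :=
  Matrix.of fun k m => if k = m + α.1 then
      eπ (-(((α.2 : ℕ) : ℂ) * (2 * (((m : ℕ) : ℂ) + 1) / N))) else 0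

lemma Imat_inv (N : ℕ) [NeZero N] (α : Fin N × Fin N) : (Imat N α)⁻¹ = Jmat N α := by
  apply Matrix.inv_eq_right_inv
  ext j m
  rw [Matrix.mul_apply]
  simp only [Imat_apply, Jmat, Matrix.of_apply, ite_mul, zero_mul, Finset.sum_ite_eq',
    Finset.sum_ite_eq, Finset.mem_univ, if_true, add_left_inj, Matrix.one_apply]
  by_cases h : j = m
  · subst h
    simp [← eπ_add', eπ_zero']
  · simp [h]

lemma geom_eπ (N : ℕ) [NeZero N] (j m : Fin N) :
    ∑ a : Fin N, eπ (((a : ℕ) : ℂ) * (2 * (((j : ℕ) : ℂ) + 1) / N)) *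
      eπ (-(((a : ℕ) : ℂ) * (2 * (((m : ℕ) : ℂ) + 1) / N))) = if j = m then (N : ℂ) else 0 := by
  split_ifs with h
  · subst h
    simp [← eπ_add', eπ_zero']
  · have hN : (N : ℂ) ≠ 0 := Nat.cast_ne_zero.mpr (NeZero.ne N)
    set x : ℂ := eπ (2 * (((j : ℕ) : ℂ) - ((m : ℕ) : ℂ)) / N) with hx
    have h1 : ∀ a : Fin N, eπ (((a : ℕ) : ℂ) * (2 * (((j : ℕ) : ℂ) + 1) / N)) *
      eπ (-(((a : ℕ) : ℂ) * (2 * (((m : ℕ) : ℂ) + 1) / N))) = x ^ (a : ℕ) := by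
      intro a
      rw [hx, eπ_pow', ← eπ_add']
      congr 1
      ring
    simp only [h1]
    rw [Fin.sum_univ_eq_sum_range (fun i => x ^ i)]
    have hx1 : x ≠ 1 := by
      intro hx1
      rw [hx, eπ, Complex.exp_eq_one_iff] at hx1
      obtain ⟨n, hn⟩ := hx1
      have hpi : (Real.pi : ℂ) ≠ 0 := Complex.ofReal_ne_zero.mpr Real.pi_ne_zero
      have h2 : ((j : ℕ) : ℂ) - ((m : ℕ) : ℂ) = n * N := by
        have hc : (2 * Real.pi * Complex.I : ℂ) ≠ 0 := Complex.two_pi_I_ne_zero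
        field_simp at hn
        linear_combination hn
      have h3 : ((j : ℕ) : ℤ) - ((m : ℕ) : ℤ) = n * N := by exact_mod_cast h2
      have h4 : (N : ℤ) ∣ ((j : ℕ) : ℤ) - ((m : ℕ) : ℤ) := ⟨n, by rw [h3]; ring⟩
      have h5 := Int.eq_zero_of_abs_lt_dvd h4 (by
        have := j.2
        have := m.2
        rw [abs_lt]; constructor <;> omega)
      exact h (Fin.ext (by omega))
    have hxN : x ^ N = 1 := by
      rw [hx, eπ_pow', eπ, Complex.exp_eq_one_iff]
      refine ⟨((j : ℕ) : ℤ) - ((m : ℕ) : ℤ), ?_⟩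
      push_cast
      field_simp
    rw [geom_sum_eq hx1, hxN]
    simp

lemma sum_Imat (N : ℕ) [NeZero N] :
    ∑ α : Fin N × Fin N, (1 / (N : ℂ)) • (Imat N α ⊗ₖ (Imat N α)⁻¹) = Pflip N := by
  have hN : (N : ℂ) ≠ 0 := Nat.cast_ne_zero.mpr (NeZero.ne N)
  ext ⟨j, k⟩ ⟨l, m⟩
  rw [← Finset.smul_sum, Matrix.smul_apply, Matrix.sum_apply, Fintype.sum_prod_type]
  have h1 : ∀ a b : Fin N, (Imat N (a, b) ⊗ₖ (Imat N (a, b))⁻¹) (j, k) (l, m) =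
      if l = j + a ∧ k = m + a then
      eπ (((b : ℕ) : ℂ) * (2 * (((j : ℕ) : ℂ) + 1) / N)) *
      eπ (-(((b : ℕ) : ℂ) * (2 * (((m : ℕ) : ℂ) + 1) / N))) else 0 := by
    intro a b
    rw [Matrix.kroneckerMap_apply, Imat_inv, Imat_apply]
    simp only [Jmat, Matrix.of_apply]
    split_ifs <;> simp_all
  have h2 : ∀ a : Fin N, ∑ b : Fin N, (Imat N (a, b) ⊗ₖ (Imat N (a, b))⁻¹) (j, k) (l, m) =
      if a = l - j then (if l = j + a ∧ k = m + a then if j = m then (N : ℂ) else 0 else 0)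
        else 0 := by
    intro a
    simp only [h1]
    rw [← geom_eπ]
    by_cases ha : l = j + a
    · have : a = l - j := by rw [ha]; abel
      rw [if_pos this]
      split_ifs <;> simp
    · simp [ha]
  simp only [h2, Finset.sum_ite_eq', Finset.mem_univ, if_true, Pflip, Matrix.of_apply]
  by_cases hjm : j = m
  · subst hjm
    simp [hN]
  · simp [hjm]

lemma gHalf_unit (N : ℕ) : IsUnit (gHalf N ⊗ₖ gHalf N).det := by
  rw [isUnit_iff_ne_zero, gHalf, Matrix.diagonal_kronecker_diagonal, Matrix.det_diagonal]
  exact Finset.prod_ne_zero_iff.mpr fun a _ => mul_ne_zero (eπ_ne_zero' _) (eπ_ne_zero' _)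

lemma gHalf_comm (N : ℕ) :
    (gHalf N ⊗ₖ gHalf N) * Pflip N = Pflip N * (gHalf N ⊗ₖ gHalf N) := by
  rw [gHalf, Matrix.diagonal_kronecker_diagonal]
  ext ⟨j, k⟩ ⟨l, m⟩
  rw [Matrix.diagonal_mul, Matrix.mul_diagonal]
  simp only [Pflip, Matrix.of_apply]
  split_ifs with h
  · obtain ⟨rfl, rfl⟩ := h
    ring
  · simp

lemma Zmat_zero (N : ℕ) [NeZero N] (ζ τ : ℂ) (h0 : Rgeneric N 0 ζ τ) :
    Zmat N 0 ζ τ = Pflip N := by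
  obtain ⟨ha, hb, hc⟩ := h0
  have hN : (N : ℂ) ≠ 0 := Nat.cast_ne_zero.mpr (NeZero.ne N)
  have hW : ∀ α : Fin N × Fin N, Wcoef N α 0 ζ τ = 1 / (N : ℂ) := by
    intro α
    have := hb α
    rw [Wcoef, zero_add, div_mul_eq_div_div_swap, div_self this]
  have hk : kappaDen N 0 ζ τ = kappaNum N 0 ζ τ := by rw [kappaDen, neg_zero]
  rw [zero_add] at ha
  rw [hk] at hc
  simp only [Zmat, hW, sum_Imat, zero_add, hk, zero_mul, eπ_zero', div_self hc, one_mul,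
    div_self ha, one_smul]

/-- The Belavin R-matrix is regular: its value at `z = 1` (i.e. at `ξ = 0`)
is the flip operator `P`. -/
theorem belavin_regularity (N : ℕ) (hN : 2 ≤ N) (ζ τ : ℂ)
    (hτ : 0 < τ.im) (hζ : 0 < ζ.im)
    (h0 : Rgeneric N 0 ζ τ) :
    Rmat N 0 ζ τ = Pflip N := by
  haveI : NeZero N := ⟨by omega⟩
  rw [Rmat, Zmat_zero N ζ τ h0, gHalf_comm, Matrix.mul_nonsing_inv_cancel_right _ _ (gHalf_unit N)]

end
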